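/- If P is a strongly connected poset (i.e., any two maximal chains are connected by a sequence of maximal chains in which consecutive chains have symmetric difference of cardinality two) and A, B are two distinct antichain cutsets of P, then A and B are disjoint. -/

import Mathlib

/-- An antichain cutset: a set intersecting each maximal chain in exactly one element. -/
def IsAntichainCutset {α : Type*} [PartialOrder α] (A : Set α) : Prop :=
  ∀ c : Set α, IsMaxChain (· ≤ ·) c → ∃! x, x ∈ c ∧ x ∈ A

/-- A poset is strongly connected if any two maximal chains are connected by a finite
sequence of maximal chains in which consecutive chains have symmetric difference of
cardinality two. -/
def StronglyConnectedOrder (α : Type*) [PartialOrder α] : Prop :=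
  ∀ c d : Set α, IsMaxChain (· ≤ ·) c → IsMaxChain (· ≤ ·) d →
    ∃ (n : ℕ) (f : ℕ → Set α), f 0 = c ∧ f n = d ∧
      (∀ i ≤ n, IsMaxChain (· ≤ ·) (f i)) ∧
      ∀ i < n, (symmDiff (f i) (f (i + 1))).ncard = 2

theorem cutset_step {α : Type*} [PartialOrder α] {A B : Set α}
    (hA : IsAntichainCutset A) (hB : IsAntichainCutset B) {c d : Set α}
    (hc : IsMaxChain (· ≤ ·) c) (hd : IsMaxChain (· ≤ ·) d)
    (hcd : (symmDiff c d).ncard = 2) (hq : ∃ x, x ∈ c ∧ x ∈ A ∧ x ∈ B) :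
    ∃ x, x ∈ d ∧ x ∈ A ∧ x ∈ B := by
  obtain ⟨x, hxc, hxA, hxB⟩ := hq
  by_cases hxd : x ∈ d
  · exact ⟨x, hxd, hxA, hxB⟩
  obtain ⟨a, ⟨had, haA⟩, -⟩ := hA d hd
  obtain ⟨b, ⟨hbd, hbB⟩, -⟩ := hB d hd
  have hac : a ∉ c := fun hac => hxd ((hA c hc).unique ⟨hxc, hxA⟩ ⟨hac, haA⟩ ▸ had)
  have hbc : b ∉ c := fun hbc => hxd ((hB c hc).unique ⟨hxc, hxB⟩ ⟨hbc, hbB⟩ ▸ hbd)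
  by_cases hab : a = b
  · exact ⟨a, had, haA, hab ▸ hbB⟩
  exfalso
  have hxa : x ≠ a := fun e => hxd (e ▸ had)
  have hxb : x ≠ b := fun e => hxd (e ▸ hbd)
  have hsub : ({x, a, b} : Set α) ⊆ symmDiff c d := by
    rintro y (rfl | rfl | rfl)
    · exact Or.inl ⟨hxc, hxd⟩
    · exact Or.inr ⟨had, hac⟩
    · exact Or.inr ⟨hbd, hbc⟩
  have hfin : (symmDiff c d).Finite := Set.finite_of_ncard_ne_zero (by omega)
  have hle := Set.ncard_le_ncard hsub hfin
  have h3 : ({x, a, b} : Set α).ncard = 3 := Set.ncard_eq_three.2 ⟨x, a, b, hxa, hxb, hab, rfl⟩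
  omega

theorem exists_maxChain_mem {α : Type*} [PartialOrder α] (x : α) :
    ∃ c : Set α, IsMaxChain (· ≤ ·) c ∧ x ∈ c := by
  obtain ⟨c, hc⟩ := (IsChain.singleton (r := (· ≤ ·)) (a := x)).exists_subset_flag
  exact ⟨c, c.maxChain, hc rfl⟩

theorem antichain_cutsets_disjoint_of_stronglyConnected {α : Type*} [PartialOrder α]
    (h : StronglyConnectedOrder α) {A B : Set α}
    (hA : IsAntichainCutset A) (hB : IsAntichainCutset B) (hAB : A ≠ B) :
    Disjoint A B := by
  rw [Set.disjoint_left]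
  intro x hxA hxB
  obtain ⟨c, hc, hxc⟩ := exists_maxChain_mem x
  have key : ∀ d : Set α, IsMaxChain (· ≤ ·) d → ∃ x, x ∈ d ∧ x ∈ A ∧ x ∈ B := by
    intro d hd
    obtain ⟨n, f, h0, hn, hmax, hstep⟩ := h c d hc hd
    have hi : ∀ i ≤ n, ∃ x, x ∈ f i ∧ x ∈ A ∧ x ∈ B := by
      intro i
      induction i with
      | zero => exact fun _ => ⟨x, h0 ▸ hxc, hxA, hxB⟩
      | succ k ih =>
        intro hk
        exact cutset_step hA hB (hmax k (by omega)) (hmax (k + 1) hk) (hstep k (by omega))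
          (ih (by omega))
    exact hn ▸ hi n le_rfl
  apply hAB
  ext y
  obtain ⟨d, hd, hyd⟩ := exists_maxChain_mem y
  obtain ⟨z, hzd, hzA, hzB⟩ := key d hd
  constructor
  · intro hy
    exact (hA d hd).unique ⟨hzd, hzA⟩ ⟨hyd, hy⟩ ▸ hzB
  · intro hy
    exact (hB d hd).unique ⟨hzd, hzB⟩ ⟨hyd, hy⟩ ▸ hzA
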